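/- Fix a finite alphabet 𝕏, finite state space 𝕊, and conditional probabilities P(x|s). Define E(R,ρ) = max over joint PMFs Q on 𝕊 × 𝕏 (with D(Q‖P) < ∞) of [ρ·min{H(Q),R} − D(Q‖P)]. Then for each fixed R > 0, E(R,ρ) is a convex function of ρ on (0,∞), and for each fixed ρ > 0, E(R,ρ) is a concave function of R on (0,∞). -/

import Mathlib

/-!
STATEMENT 14: With `𝕏`, `𝕊` finite and conditional probabilities `P (x|s)`,
define `E(R,ρ) = max over joint PMFs Q on 𝕊 × 𝕏 with D(Q‖P) < ∞ of
[ρ min{H(Q), R} − D(Q‖P)]`. Then for each fixed `R > 0`, `ρ ↦ E(R,ρ)` is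
convex on `(0,∞)`, and for each fixed `ρ > 0`, `R ↦ E(R,ρ)` is concave on `(0,∞)`.
-/

noncomputable section

/-- Conditional entropy `H(Q) = -∑_{s,a} Q(a,s) log₂ q(a|s)` where
`q(a|s) = Q(a,s)/Q(s)` (conventions `0 log 0 = 0`, `x/0 = 0`, `log 0 = 0`). -/
def condEnt {𝕏 𝕊 : Type*} [Fintype 𝕏] [Fintype 𝕊] (Q : 𝕏 → 𝕊 → ℝ) : ℝ :=
  -∑ s : 𝕊, ∑ a : 𝕏, Q a s * Real.logb 2 (Q a s / ∑ b : 𝕏, Q b s)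

/-- Conditional divergence `D(Q‖P) = ∑_{s,a} Q(a,s) log₂ (q(a|s)/P(a|s))`. -/
def condDiv {𝕏 𝕊 : Type*} [Fintype 𝕏] [Fintype 𝕊] (Q P : 𝕏 → 𝕊 → ℝ) : ℝ :=
  ∑ s : 𝕊, ∑ a : 𝕏, Q a s * Real.logb 2 ((Q a s / ∑ b : 𝕏, Q b s) / P a s)

lemma aux_log {x w : ℝ} (hx : 0 ≤ x) (hw : 0 ≤ w) (h : 0 < x → 0 < w) :
    x - w ≤ x * Real.log (x / w) := by
  rcases hx.eq_or_lt with rfl | hx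
  · simpa using hw
  · have hw := h hx
    have h1 := Real.one_sub_inv_le_log_of_pos (div_pos hx hw)
    have h2 := mul_le_mul_of_nonneg_left h1 hx.le
    have h3 : x * (1 - (x / w)⁻¹) = x - w := by field_simp
    linarith

lemma aux_log_t {x w t : ℝ} (ht : 0 < t) (hx : 0 ≤ x) (hw : 0 ≤ w) (h : 0 < x → 0 < w) :
    x * Real.log t + x - w * t ≤ x * Real.log (x / w) := by
  have h1 := aux_log hx (mul_nonneg hw ht.le) (fun h' => mul_pos (h h') ht)
  rcases hx.eq_or_lt with rfl | hx
  · simp at h1 ⊢; exact h1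
  · have hw := h hx
    have : Real.log (x / w) = Real.log (x / (w * t)) + Real.log t := by
      rw [← Real.log_mul (by positivity) ht.ne']
      congr 1
      field_simp
    rw [this]; linarith

lemma aux_logsum {x y u v : ℝ} (hx : 0 ≤ x) (hy : 0 ≤ y) (hu : 0 ≤ u) (hv : 0 ≤ v)
    (hxu : 0 < x → 0 < u) (hyv : 0 < y → 0 < v) :
    (x + y) * Real.log ((x + y) / (u + v)) ≤ x * Real.log (x / u) + y * Real.log (y / v) := by
  rcases (add_nonneg hx hy).eq_or_lt with h | h
  · have h1 : x = 0 := by linarith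
    have h2 : y = 0 := by linarith
    simp [h1, h2]
  · have hw : 0 < u + v := by
      rcases hx.eq_or_lt with h0 | h0
      · have := hyv (by linarith); linarith
      · have := hxu h0; linarith
    have ht := div_pos h hw
    have h1 := aux_log_t ht hx hu hxu
    have h2 := aux_log_t ht hy hv hyv
    have h3 : (u + v) * ((x + y) / (u + v)) = x + y := by field_simp
    linarith

lemma aux_scale (a x w : ℝ) : (a * x) * Real.log ((a * x) / (a * w)) =
    a * (x * Real.log (x / w)) := by
  rcases eq_or_ne a 0 with rfl | h
  · simp
  · rw [mul_div_mul_left _ _ h, mul_assoc]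

lemma marg_pos {𝕏 𝕊 : Type*} [Fintype 𝕏] {Q : 𝕏 → 𝕊 → ℝ} (h : ∀ a s, 0 ≤ Q a s)
    (a : 𝕏) (s : 𝕊) (hp : 0 < Q a s) : 0 < ∑ b, Q b s :=
  hp.trans_le (Finset.single_le_sum (f := fun b => Q b s) (fun b _ => h b s) (Finset.mem_univ a))

lemma condDiv_convex {𝕏 𝕊 : Type*} [Fintype 𝕏] [Fintype 𝕊] (P Q₁ Q₂ : 𝕏 → 𝕊 → ℝ)
    (hP0 : ∀ a s, 0 ≤ P a s)
    (h1 : ∀ a s, 0 ≤ Q₁ a s) (h2 : ∀ a s, 0 ≤ Q₂ a s)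
    (h1P : ∀ a s, 0 < Q₁ a s → 0 < P a s) (h2P : ∀ a s, 0 < Q₂ a s → 0 < P a s)
    {c d : ℝ} (hc : 0 ≤ c) (hd : 0 ≤ d) :
    condDiv (fun a s => c * Q₁ a s + d * Q₂ a s) P ≤ c * condDiv Q₁ P + d * condDiv Q₂ P := by
  unfold condDiv
  simp only [Finset.mul_sum, ← Finset.sum_add_distrib]
  refine Finset.sum_le_sum fun s _ => Finset.sum_le_sum fun a _ => ?_
  rw [Finset.sum_add_distrib, ← Finset.mul_sum, ← Finset.mul_sum]
  have m1 := marg_pos h1 a s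
  have m2 := marg_pos h2 a s
  have n1 : 0 ≤ ∑ b, Q₁ b s := Finset.sum_nonneg fun b _ => h1 b s
  have n2 : 0 ≤ ∑ b, Q₂ b s := Finset.sum_nonneg fun b _ => h2 b s
  generalize ∑ b, Q₁ b s = y1 at *
  generalize ∑ b, Q₂ b s = y2 at *
  have p1 := h1P a s
  have p2 := h2P a s
  have k1 := h1 a s
  have k2 := h2 a s
  have p0 := hP0 a s
  generalize Q₁ a s = x1 at *
  generalize Q₂ a s = x2 at *
  generalize P a s = p at *
  have key : ∀ {e x y : ℝ}, 0 ≤ e → (0 < x → 0 < y) → (0 < x → 0 < p) → 0 ≤ x →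
      0 < e * x → 0 < e * (y * p) := by
    intro e x y he hxy hxp hx h
    have hx' : 0 < x := hx.lt_of_ne (by rintro rfl; simp at h)
    have he' : 0 < e := he.lt_of_ne (by rintro rfl; simp at h)
    exact mul_pos he' (mul_pos (hxy hx') (hxp hx'))
  have main := aux_logsum (mul_nonneg hc k1) (mul_nonneg hd k2)
    (mul_nonneg hc (mul_nonneg n1 p0)) (mul_nonneg hd (mul_nonneg n2 p0))
    (key hc m1 p1 k1) (key hd m2 p2 k2)
  rw [aux_scale, aux_scale] at main
  have hl : 0 < Real.log 2 := Real.log_pos (by norm_num)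
  simp only [Real.logb, div_div]
  have e1 : c * (y1 * p) + d * (y2 * p) = (c * y1 + d * y2) * p := by ring
  rw [e1] at main
  have := div_le_div_of_nonneg_right main hl.le
  calc _ = _ := by rw [mul_div_assoc']
    _ ≤ _ := this
    _ = _ := by ring

lemma condDiv_nonneg {𝕏 𝕊 : Type*} [Fintype 𝕏] [Fintype 𝕊] (P Q : 𝕏 → 𝕊 → ℝ)
    (hP0 : ∀ a s, 0 ≤ P a s) (hP1 : ∀ s, ∑ a : 𝕏, P a s = 1)
    (h : ∀ a s, 0 ≤ Q a s) (hP : ∀ a s, 0 < Q a s → 0 < P a s) : 0 ≤ condDiv Q P := by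
  unfold condDiv
  refine Finset.sum_nonneg fun s _ => ?_
  have hl : 0 < Real.log 2 := Real.log_pos (by norm_num)
  have n : 0 ≤ ∑ b, Q b s := Finset.sum_nonneg fun b _ => h b s
  have h0 : ∑ a, (Q a s - (∑ b, Q b s) * P a s) = 0 := by
    rw [Finset.sum_sub_distrib, ← Finset.mul_sum, hP1]; ring
  have h1 : 0 ≤ ∑ a, Q a s * Real.log (Q a s / ((∑ b, Q b s) * P a s)) := by
    rw [← h0]
    exact Finset.sum_le_sum fun a _ => aux_log (h a s) (mul_nonneg n (hP0 a s))
      fun hq => mul_pos (marg_pos h a s hq) (hP a s hq)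
  have := div_nonneg h1 hl.le
  rw [Finset.sum_div] at this
  simpa only [Real.logb, div_div, mul_div_assoc] using this

lemma condEnt_eq {𝕏 𝕊 : Type*} [Fintype 𝕏] [Fintype 𝕊] (Q : 𝕏 → 𝕊 → ℝ) :
    condEnt Q = - condDiv Q (fun _ _ => 1) := by
  simp [condEnt, condDiv]

theorem stmt_14 {𝕏 𝕊 : Type*} [Fintype 𝕏] [Nonempty 𝕏] [Fintype 𝕊] [Nonempty 𝕊]
    (P : 𝕏 → 𝕊 → ℝ) (hP0 : ∀ a s, 0 ≤ P a s) (hP1 : ∀ s, ∑ a : 𝕏, P a s = 1)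
    (E : ℝ → ℝ → ℝ)
    (hE : ∀ R ρ : ℝ, E R ρ = sSup {v : ℝ | ∃ Q : 𝕏 → 𝕊 → ℝ,
      (∀ a s, 0 ≤ Q a s) ∧ (∑ s : 𝕊, ∑ a : 𝕏, Q a s = 1) ∧
      (∀ a s, 0 < Q a s → 0 < P a s) ∧
      v = ρ * min (condEnt Q) R - condDiv Q P}) :
    (∀ R : ℝ, 0 < R → ConvexOn ℝ (Set.Ioi (0 : ℝ)) fun ρ => E R ρ) ∧
    (∀ ρ : ℝ, 0 < ρ → ConcaveOn ℝ (Set.Ioi (0 : ℝ)) fun R => E R ρ) := by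
  have hbdd : ∀ R ρ : ℝ, 0 < ρ → BddAbove {v : ℝ | ∃ Q : 𝕏 → 𝕊 → ℝ,
      (∀ a s, 0 ≤ Q a s) ∧ (∑ s : 𝕊, ∑ a : 𝕏, Q a s = 1) ∧
      (∀ a s, 0 < Q a s → 0 < P a s) ∧
      v = ρ * min (condEnt Q) R - condDiv Q P} := by
    intro R ρ hρ
    refine ⟨ρ * R, ?_⟩
    rintro v ⟨Q, h0, h1, h2, rfl⟩
    have := condDiv_nonneg P Q hP0 hP1 h0 h2
    have := mul_le_mul_of_nonneg_left (min_le_right (condEnt Q) R) hρ.le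
    linarith
  have hne : ∀ R ρ : ℝ, Set.Nonempty {v : ℝ | ∃ Q : 𝕏 → 𝕊 → ℝ,
      (∀ a s, 0 ≤ Q a s) ∧ (∑ s : 𝕊, ∑ a : 𝕏, Q a s = 1) ∧
      (∀ a s, 0 < Q a s → 0 < P a s) ∧
      v = ρ * min (condEnt Q) R - condDiv Q P} := by
    intro R ρ
    have hc : (0 : ℝ) < Fintype.card 𝕊 := by exact_mod_cast Fintype.card_pos
    refine ⟨_, fun a s => P a s / Fintype.card 𝕊, fun a s => div_nonneg (hP0 a s) hc.le, ?_, ?_, rfl⟩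
    · simp only [← Finset.sum_div, hP1]
      simp
    · intro a s h
      exact (div_pos_iff_of_pos_right hc).1 h
  constructor
  · intro R _
    refine ⟨convex_Ioi 0, ?_⟩
    intro x hx y hy c d hc hd hcd
    simp only [smul_eq_mul]
    rw [hE R (c * x + d * y)]
    refine csSup_le (hne _ _) ?_
    rintro v ⟨Q, h0, h1, h2, rfl⟩
    have e1 : x * min (condEnt Q) R - condDiv Q P ≤ E R x := by
      rw [hE]; exact le_csSup (hbdd R x hx) ⟨Q, h0, h1, h2, rfl⟩
    have e2 : y * min (condEnt Q) R - condDiv Q P ≤ E R y := by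
      rw [hE]; exact le_csSup (hbdd R y hy) ⟨Q, h0, h1, h2, rfl⟩
    have e3 := mul_le_mul_of_nonneg_left e1 hc
    have e4 := mul_le_mul_of_nonneg_left e2 hd
    have e5 : condDiv Q P = c * condDiv Q P + d * condDiv Q P := by rw [← add_mul, hcd, one_mul]
    linarith
  · intro ρ hρ
    refine ⟨convex_Ioi 0, ?_⟩
    intro x hx y hy c d hc hd hcd
    simp only [smul_eq_mul]
    refine le_of_forall_pos_le_add fun ε hε => ?_
    obtain ⟨v1, ⟨Q₁, h10, h11, h12, rfl⟩, hv1⟩ := exists_lt_of_lt_csSup (hne x ρ)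
      (show E x ρ - ε < _ by rw [← hE x ρ]; linarith)
    obtain ⟨v2, ⟨Q₂, h20, h21, h22, rfl⟩, hv2⟩ := exists_lt_of_lt_csSup (hne y ρ)
      (show E y ρ - ε < _ by rw [← hE y ρ]; linarith)
    have hD := condDiv_convex P Q₁ Q₂ hP0 h10 h20 h12 h22 hc hd
    have hH := condDiv_convex (fun _ _ => 1) Q₁ Q₂ (fun _ _ => zero_le_one) h10 h20
      (fun _ _ _ => one_pos) (fun _ _ _ => one_pos) hc hd
    have hle : ρ * min (condEnt fun a s => c * Q₁ a s + d * Q₂ a s) (c * x + d * y)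
        - condDiv (fun a s => c * Q₁ a s + d * Q₂ a s) P ≤ E (c * x + d * y) ρ := by
      rw [hE]
      refine le_csSup (hbdd _ ρ hρ) ⟨_, ?_, ?_, ?_, rfl⟩
      · intro a s
        exact add_nonneg (mul_nonneg hc (h10 a s)) (mul_nonneg hd (h20 a s))
      · simp only [Finset.sum_add_distrib, ← Finset.mul_sum, h11, h21]
        linarith
      · intro a s h
        by_contra hp
        have z1 : Q₁ a s = 0 := le_antisymm (not_lt.1 fun h' => hp (h12 a s h')) (h10 a s)
        have z2 : Q₂ a s = 0 := le_antisymm (not_lt.1 fun h' => hp (h22 a s h')) (h20 a s)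
        simp [z1, z2] at h
    have hmin : c * min (condEnt Q₁) x + d * min (condEnt Q₂) y ≤
        min (condEnt fun a s => c * Q₁ a s + d * Q₂ a s) (c * x + d * y) := by
      refine le_min ?_ ?_
      · have i1 := mul_le_mul_of_nonneg_left (min_le_left (condEnt Q₁) x) hc
        have i2 := mul_le_mul_of_nonneg_left (min_le_left (condEnt Q₂) y) hd
        have j1 := condEnt_eq Q₁
        have j2 := condEnt_eq Q₂
        have j3 := condEnt_eq fun a s => c * Q₁ a s + d * Q₂ a s
        have k1 : c * condEnt Q₁ = - (c * condDiv Q₁ fun _ _ => 1) := by rw [j1]; ring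
        have k2 : d * condEnt Q₂ = - (d * condDiv Q₂ fun _ _ => 1) := by rw [j2]; ring
        linarith
      · have i1 := mul_le_mul_of_nonneg_left (min_le_right (condEnt Q₁) x) hc
        have i2 := mul_le_mul_of_nonneg_left (min_le_right (condEnt Q₂) y) hd
        linarith
    have hm := mul_le_mul_of_nonneg_left hmin hρ.le
    have w1 := mul_le_mul_of_nonneg_left hv1.le hc
    have w2 := mul_le_mul_of_nonneg_left hv2.le hd
    have w3 : c * ε + d * ε = ε := by rw [← add_mul, hcd, one_mul]
    linarith

end
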